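/- For all integers x, y, z ≥ 1 and a, b ≥ 1, one has φ_{x,y-1,z}(a,b) · φ_{x,y,z-1}(a,b) / ( φ_{x,y-1,z-1}(a,b) · φ_{x,y,z}(a,b) ) = (2x+y+z+2a+2b)(2y+2z+2a+2b-1) / ( (2x+2y+2z+2a+2b-1)(x+y+z+2a+2b) ). -/

import Mathlib

open Finset Nat

/-- Pochhammer symbol `(q)_n` for real `q` and integer `n`. -/
noncomputable def poch (q : ℝ) (n : ℤ) : ℝ :=
  if 0 ≤ n then ∏ i ∈ Finset.range n.toNat, (q + i)
  else 1 / ∏ i ∈ Finset.range (-n).toNat, (q - (i + 1))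

/-- Skipping Pochhammer symbol `[q]_n`. -/
noncomputable def spoch (q : ℝ) (n : ℤ) : ℝ :=
  if 0 ≤ n then ∏ i ∈ Finset.range n.toNat, (q + 2 * i)
  else 1 / ∏ i ∈ Finset.range (-n).toNat, (q - 2 * (i + 1))

/-- Trapezoidal product `T(q,n,m) = ∏_{i=0}^{m-1} (q+i)_{n-2i}`. -/
noncomputable def trapT (q : ℝ) (n m : ℤ) : ℝ :=
  ∏ i ∈ Finset.range m.toNat, poch (q + i) (n - 2 * i)

/-- Skipping trapezoidal product `V(q,n,m) = ∏_{i=0}^{m-1} [q+2i]_{n-2i}`. -/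
noncomputable def trapV (q : ℝ) (n m : ℤ) : ℝ :=
  ∏ i ∈ Finset.range m.toNat, spoch (q + 2 * i) (n - 2 * i)

/-- Hyperfactorial `H(n) = 0!·1!·2!⋯(n-1)!`. -/
def hyperfac (n : ℕ) : ℕ := ∏ i ∈ Finset.range n, i !

/-- Skipping hyperfactorial `H₂(n)`:
`0!·2!·4!⋯(n-2)!` if `n` is even, `1!·3!·5!⋯(n-2)!` if `n` is odd. -/
def hyperfac2 (n : ℕ) : ℕ :=
  ∏ i ∈ Finset.range (n / 2), (if n % 2 = 0 then (2 * i)! else (2 * i + 1)!)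

/-- Partial sum `s_k(t) = t 1 + ⋯ + t k` (sequences are indexed from 1). -/
def pSum (t : ℕ → ℕ) (k : ℕ) : ℕ := ∑ i ∈ Finset.Icc 1 k, t i

/-- `E(t) = t 2 + t 4 + ⋯ + t (2l)` for a sequence of length `2l`. -/
def evenSum (l : ℕ) (t : ℕ → ℕ) : ℕ := ∑ i ∈ Finset.Icc 1 l, t (2 * i)

/-- `Q(t₁,…,t_{2l})`. -/
noncomputable def Qfun (l : ℕ) (t : ℕ → ℕ) : ℝ :=
  ((∏ i ∈ Finset.Icc 1 l, ((pSum t (2 * i))! : ℝ) / ((pSum t (2 * i - 1))! : ℝ)) /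
      (hyperfac2 (2 * evenSum l t + 1) : ℝ)) *
    (∏ i ∈ Finset.Icc 1 l,
      ((hyperfac2 (2 * pSum t (2 * i) + 1) : ℝ) * (hyperfac (2 * pSum t (2 * i - 1) + 2) : ℝ)) /
        (hyperfac2 (2 * pSum t (2 * i - 1) + 3) : ℝ)) *
    (∏ p ∈ (Finset.Icc 1 (2 * l) ×ˢ Finset.Icc 1 (2 * l)).filter
        (fun p => p.1 < p.2 ∧ (p.2 - p.1) % 2 = 1),
      (hyperfac (pSum t p.2 - pSum t p.1) : ℝ) / (hyperfac (pSum t p.2 + pSum t p.1 + 1) : ℝ)) *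
    (∏ p ∈ (Finset.Icc 1 (2 * l) ×ˢ Finset.Icc 1 (2 * l)).filter
        (fun p => p.1 < p.2 ∧ (p.2 - p.1) % 2 = 0),
      (hyperfac (pSum t p.2 + pSum t p.1 + 1) : ℝ) / (hyperfac (pSum t p.2 - pSum t p.1) : ℝ))

/-- Build an indexed-from-1 sequence from a list. -/
def seqOf (L : List ℕ) : ℕ → ℕ := fun i => L.getD (i - 1) 0

/-- `Q` on four entries. -/
noncomputable def Q4 (t1 t2 t3 t4 : ℕ) : ℝ := Qfun 2 (seqOf [t1, t2, t3, t4])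

/-- Proctor's product formula `P_{a,b,c}`. -/
noncomputable def Pf (a b c : ℕ) : ℝ :=
  ∏ i ∈ Finset.Icc 1 a,
    ((∏ j ∈ Finset.Icc 1 (b - a + 1), ((c + i + j - 1 : ℕ) : ℝ) / ((i + j - 1 : ℕ) : ℝ)) *
      ∏ j ∈ Finset.Icc (b - a + 2) (b - a + i),
        ((2 * c + i + j - 1 : ℕ) : ℝ) / ((i + j - 1 : ℕ) : ℝ))

/-- Ciucu's product formula `P′_{a,b,c}`. -/
noncomputable def Pf' (a b c : ℕ) : ℝ :=
  (2 : ℝ) ^ (-(a : ℤ)) *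
    (∏ i ∈ Finset.Icc 1 a, ((2 * c + (b - a) + i : ℕ) : ℝ) / ((c + (b - a) + i : ℕ) : ℝ)) *
    Pf a b c

/-- `φ_{x,y,z}(a,b)`. -/
noncomputable def phi (x y z a b : ℕ) : ℝ :=
  (Pf y (y + 2 * a) b * Pf (z + b) (z + b) a * Q4 a b x (y + z) /
      Pf (y + z + b) (y + z + b) a) *
    (trapT ((x : ℝ) + b + 1) ((y : ℤ) + a - 1) a *
      trapT ((x : ℝ) + z + a + b + 2) ((y : ℤ) + a - 1) a *
      trapT (2 * (a : ℝ) + b + 2) ((y : ℤ) + b - 1) b *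
      trapT ((z : ℝ) + 1) ((y : ℤ) + b - 1) b) /
    (trapT ((b : ℝ) + 1) ((y : ℤ) + a - 1) a *
      trapT ((z : ℝ) + a + b + 2) ((y : ℤ) + a - 1) a *
      trapT ((x : ℝ) + 2 * a + b + 2) ((y : ℤ) + b - 1) b *
      trapT ((x : ℝ) + z + 1) ((y : ℤ) + b - 1) b)

/-- `ψ_{x,y,z}(a,b)`. -/
noncomputable def psi (x y z a b : ℕ) : ℝ :=
  (Pf' y (y + 2 * a + 1) b * Pf (z + b) (z + b) a * Q4 a b x (y + z) /
      Pf (y + z + b) (y + z + b) a) *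
    (trapV (2 * (a : ℝ) + 2 * b + 3) ((y : ℤ) + z - 1) y /
      trapV (2 * (x : ℝ) + 2 * a + 2 * b + 3) ((y : ℤ) + z - 1) y) *
    (trapT ((x : ℝ) + b + 1) ((y : ℤ) + z + 2 * a) y *
      trapT (2 * (a : ℝ) + b + 2) ((y : ℤ) + b - 1) b *
      trapT ((z : ℝ) + 1) ((y : ℤ) + b - 1) b) /
    (trapT ((b : ℝ) + 1) ((y : ℤ) + z + 2 * a) y *
      trapT ((x : ℝ) + 2 * a + b + 2) ((y : ℤ) + b - 1) b *
      trapT ((x : ℝ) + z + 1) ((y : ℤ) + b - 1) b)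

noncomputable def wFac (N m : ℕ) : ℝ := ∏ i ∈ Finset.range m, ((N + i)! : ℝ)

lemma wFac_ne (N m : ℕ) : wFac N m ≠ 0 := by
  unfold wFac
  exact Finset.prod_ne_zero_iff.mpr fun i _ => by positivity

lemma wFac_succ (N m : ℕ) : wFac (N + 1) m * (N ! : ℝ) = wFac N m * ((N + m)! : ℝ) := by
  unfold wFac
  rw [← Finset.prod_range_succ (fun i => ((N + i)! : ℝ)), Finset.prod_range_succ']
  simp [add_assoc, add_comm 1]

lemma poch_fac (k l : ℕ) : poch ((k : ℝ) + 1) ((l : ℤ) - k) = (l ! : ℝ) / (k ! : ℝ) := by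
  have key : ∀ k d : ℕ, (k ! : ℝ) * ∏ i ∈ Finset.range d, ((k : ℝ) + 1 + i) = ((k + d)! : ℝ) := by
    intro k d
    induction d with
    | zero => simp
    | succ d ih =>
      rw [Finset.prod_range_succ, ← mul_assoc, ih, ← add_assoc, Nat.factorial_succ]
      push_cast
      ring
  unfold poch
  have hk : (k ! : ℝ) ≠ 0 := by positivity
  have hl : (l ! : ℝ) ≠ 0 := by positivity
  split_ifs with h
  · obtain ⟨d, rfl⟩ : ∃ d, l = k + d := ⟨l - k, by omega⟩
    have : ((k + d : ℕ) - k : ℤ).toNat = d := by omega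
    rw [this, ← key k d]
    field_simp
  · obtain ⟨d, rfl⟩ : ∃ d, k = l + d := ⟨k - l, by omega⟩
    have : (-((l : ℤ) - (l + d : ℕ))).toNat = d := by omega
    rw [this, ← key l d] 
    have e : ∏ i ∈ Finset.range d, (((l + d : ℕ) : ℝ) + 1 - (i + 1))
        = ∏ i ∈ Finset.range d, ((l : ℝ) + 1 + i) := by
      rw [← Finset.prod_range_reflect]
      refine Finset.prod_congr rfl fun i hi => ?_
      have hi' := Finset.mem_range.mp hi
      have : ((d - 1 - i : ℕ) : ℝ) = d - 1 - i := by
        rw [Nat.sub_sub, Nat.cast_sub (by omega)]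
        push_cast
        ring
      rw [this]
      push_cast
      ring
    rw [e]
    have := key l d
    have h2 : (∏ i ∈ Finset.range d, ((l : ℝ) + 1 + i)) ≠ 0 := by
      refine Finset.prod_ne_zero_iff.mpr fun i _ => by positivity
    field_simp

lemma trapT_fac (q : ℝ) (k y m : ℕ) (hq : q = (k : ℝ) + 1) :
    trapT q ((y : ℤ) + m - 1) m = wFac (k + y) m / wFac k m := by
  subst hq
  unfold trapT wFac
  rw [← Finset.prod_range_reflect (fun i => ((k + y + i)! : ℝ)), ← Finset.prod_div_distrib,
    Int.toNat_natCast]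
  refine Finset.prod_congr rfl fun i hi => ?_
  have hi' := Finset.mem_range.mp hi
  rw [← poch_fac]
  congr 1
  · push_cast
    ring
  · push_cast
    omega

lemma hyperfac_succ (n : ℕ) : (hyperfac (n + 1) : ℝ) = hyperfac n * (n ! : ℝ) := by
  unfold hyperfac
  rw [Finset.prod_range_succ]
  push_cast
  rfl

lemma hyperfac_ne (n : ℕ) : (hyperfac n : ℝ) ≠ 0 := by
  unfold hyperfac
  exact_mod_cast Finset.prod_ne_zero_iff.mpr fun i _ => Nat.factorial_ne_zero i

lemma hyperfac2_odd (n : ℕ) : hyperfac2 (2 * n + 1) = ∏ i ∈ Finset.range n, (2 * i + 1)! := by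
  unfold hyperfac2
  rw [show (2 * n + 1) / 2 = n by omega]
  refine Finset.prod_congr rfl fun i _ => ?_
  rw [if_neg (by omega)]

lemma hyperfac2_succ (n : ℕ) :
    (hyperfac2 (2 * (n + 1) + 1) : ℝ) = hyperfac2 (2 * n + 1) * ((2 * n + 1)! : ℝ) := by
  rw [hyperfac2_odd, hyperfac2_odd, Finset.prod_range_succ]
  push_cast
  rfl

lemma hyperfac2_ne (n : ℕ) : (hyperfac2 n : ℝ) ≠ 0 := by
  unfold hyperfac2
  have : (∏ i ∈ Finset.range (n / 2), (if n % 2 = 0 then (2 * i)! else (2 * i + 1)!)) ≠ 0 :=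
    Finset.prod_ne_zero_iff.mpr fun i _ => by split_ifs <;> exact Nat.factorial_ne_zero _
  exact_mod_cast this

lemma hyperfac_ne0 (n : ℕ) : hyperfac n ≠ 0 := by exact_mod_cast hyperfac_ne n

lemma hyperfac2_ne0 (n : ℕ) : hyperfac2 n ≠ 0 := by exact_mod_cast hyperfac2_ne n

noncomputable def kQ (a b x s : ℕ) : ℝ :=
  ((a + b + x + s)! : ℝ) / (hyperfac2 (2 * (b + s) + 1) : ℝ) *
    (hyperfac2 (2 * (a + b + x + s) + 1) : ℝ) *
    ((hyperfac (b + x + s) : ℝ) * (hyperfac s : ℝ) * (hyperfac (a + b + x + s + (a + b) + 1) : ℝ)) /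
    ((hyperfac (a + b + x + s + a + 1) : ℝ) * (hyperfac (a + b + x + s + (a + b + x) + 1) : ℝ) *
      (hyperfac (x + s) : ℝ))

lemma Q4_form (a b x : ℕ) : ∃ C : ℝ, C ≠ 0 ∧ ∀ s, Q4 a b x s = C * kQ a b x s := by
  have p1 : ∀ s, pSum (seqOf [a, b, x, s]) 1 = a := by intro s; simp [pSum, seqOf]
  have p2 : ∀ s, pSum (seqOf [a, b, x, s]) 2 = a + b := by
    intro s; simp [pSum, seqOf, Finset.sum_Icc_succ_top]
  have p3 : ∀ s, pSum (seqOf [a, b, x, s]) 3 = a + b + x := by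
    intro s; simp [pSum, seqOf, Finset.sum_Icc_succ_top]
  have p4 : ∀ s, pSum (seqOf [a, b, x, s]) 4 = a + b + x + s := by
    intro s; simp [pSum, seqOf, Finset.sum_Icc_succ_top]
  have pe : ∀ s, evenSum 2 (seqOf [a, b, x, s]) = b + s := by
    intro s; simp [evenSum, seqOf, Finset.sum_Icc_succ_top]
  have f1 : (Finset.Icc 1 (2 * 2) ×ˢ Finset.Icc 1 (2 * 2)).filter
        (fun p : ℕ × ℕ => p.1 < p.2 ∧ (p.2 - p.1) % 2 = 1) = {(1, 2), (1, 4), (2, 3), (3, 4)} := by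
    decide
  have f0 : (Finset.Icc 1 (2 * 2) ×ˢ Finset.Icc 1 (2 * 2)).filter
        (fun p : ℕ × ℕ => p.1 < p.2 ∧ (p.2 - p.1) % 2 = 0) = {(1, 3), (2, 4)} := by
    decide
  have fi : Finset.Icc 1 2 = ({1, 2} : Finset ℕ) := by decide
  refine ⟨((a + b)! : ℝ) / (a ! : ℝ) / ((a + b + x)! : ℝ) *
    ((hyperfac2 (2 * (a + b) + 1) : ℝ) * (hyperfac (2 * a + 2) : ℝ) / (hyperfac2 (2 * a + 3) : ℝ)) *
    ((hyperfac (2 * (a + b + x) + 2) : ℝ) / (hyperfac2 (2 * (a + b + x) + 3) : ℝ)) *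
    ((hyperfac b : ℝ) / (hyperfac (a + b + a + 1) : ℝ)) *
    ((hyperfac x : ℝ) / (hyperfac (a + b + x + (a + b) + 1) : ℝ)) *
    ((hyperfac (a + b + x + a + 1) : ℝ) / (hyperfac (b + x) : ℝ)), ?_, ?_⟩
  · simp [hyperfac_ne0, hyperfac2_ne0, Nat.factorial_ne_zero]
  · intro s
    unfold Q4 Qfun kQ
    rw [f1, f0, fi, pe]
    rw [Finset.prod_insert (by decide), Finset.prod_insert (by decide),
      Finset.prod_insert (by decide), Finset.prod_insert (by decide), Finset.prod_insert (by decide),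
      Finset.prod_insert (by decide)]
    simp only [Finset.prod_singleton, Nat.reduceMul, Nat.reduceSub, p1, p2, p3, p4]
    rw [show a + b - a = b by omega, show a + b + x + s - a = b + x + s by omega,
      show a + b + x - (a + b) = x by omega, show a + b + x + s - (a + b + x) = s by omega,
      show a + b + x - a = b + x by omega, show a + b + x + s - (a + b) = x + s by omega]
    ring

lemma kQ_ne (a b x s : ℕ) : kQ a b x s ≠ 0 := by
  unfold kQ
  simp [hyperfac_ne0, hyperfac2_ne0, Nat.factorial_ne_zero]

lemma kQ_succ (a b x s : ℕ) : kQ a b x (s + 1) = kQ a b x s *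
    (((a + b + x + s : ℕ) + 1 : ℝ) / ((2 * (b + s) + 1)! : ℝ) * ((2 * (a + b + x + s) + 1)! : ℝ) *
      (((b + x + s)! : ℝ) * (s ! : ℝ) * ((a + b + x + s + (a + b) + 1)! : ℝ)) /
      (((a + b + x + s + a + 1)! : ℝ) * ((a + b + x + s + (a + b + x) + 1)! : ℝ) *
        ((x + s)! : ℝ))) := by
  unfold kQ
  rw [show a + b + x + (s + 1) + (a + b) + 1 = (a + b + x + s + (a + b) + 1) + 1 by ring,
    show a + b + x + (s + 1) + a + 1 = (a + b + x + s + a + 1) + 1 by ring,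
    show a + b + x + (s + 1) + (a + b + x) + 1 = (a + b + x + s + (a + b + x) + 1) + 1 by ring,
    show a + b + x + (s + 1) = (a + b + x + s) + 1 by ring,
    show b + x + (s + 1) = (b + x + s) + 1 by ring,
    show b + (s + 1) = (b + s) + 1 by ring, show x + (s + 1) = (x + s) + 1 by ring]
  simp only [hyperfac_succ, hyperfac2_succ]
  rw [Nat.factorial_succ (a + b + x + s)]
  push_cast
  ring

lemma Pf_ne (a b c : ℕ) : Pf a b c ≠ 0 := by
  unfold Pf
  refine Finset.prod_ne_zero_iff.mpr fun i hi => ?_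
  have hi' := Finset.mem_Icc.mp hi
  refine mul_ne_zero (Finset.prod_ne_zero_iff.mpr fun j hj => ?_)
    (Finset.prod_ne_zero_iff.mpr fun j hj => ?_) <;>
  · have hj' := Finset.mem_Icc.mp hj
    refine div_ne_zero ?_ ?_ <;>
    · rw [Nat.cast_ne_zero]
      omega

lemma prod_Icc_fac (k n : ℕ) :
    ((k + 1)! : ℝ) * ∏ j ∈ Finset.Icc 2 (n + 1), ((k + j : ℕ) : ℝ) = ((k + n + 1)! : ℝ) := by
  induction n with
  | zero => simp
  | succ n ih =>
    rw [Finset.prod_Icc_succ_top (by omega), ← mul_assoc, ih,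
      show k + (n + 1) + 1 = (k + n + 1) + 1 by ring, Nat.factorial_succ (k + n + 1)]
    push_cast
    ring

lemma Pf_succ (n c : ℕ) : Pf (n + 1) (n + 1) c = Pf n n c *
    (((c + n + 1 : ℕ) : ℝ) / ((n + 1 : ℕ) : ℝ) * (((2 * c + 2 * n + 1)! : ℝ) / ((2 * c + n + 1)! : ℝ)) *
      (((n + 1)! : ℝ) / ((2 * n + 1)! : ℝ))) := by
  unfold Pf
  rw [Finset.prod_Icc_succ_top (by omega)]
  simp only [Nat.sub_self, zero_add, Finset.Icc_self, Finset.prod_singleton, Nat.add_sub_cancel]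
  congr 1
  rw [Finset.prod_div_distrib, mul_assoc]
  congr 1
  have e1 : ∏ j ∈ Finset.Icc 2 (n + 1), ((2 * c + (n + 1) + j - 1 : ℕ) : ℝ)
      = ((2 * c + 2 * n + 1)! : ℝ) / ((2 * c + n + 1)! : ℝ) := by
    rw [eq_div_iff (by positivity), mul_comm, show 2 * c + 2 * n + 1 = 2 * c + n + n + 1 by ring,
      ← prod_Icc_fac (2 * c + n) n]
    congr 1
    refine Finset.prod_congr rfl fun j _ => ?_
    congr 1
    omega
  have e2 : ∏ j ∈ Finset.Icc 2 (n + 1), ((n + 1 + j - 1 : ℕ) : ℝ)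
      = ((2 * n + 1)! : ℝ) / ((n + 1)! : ℝ) := by
    rw [eq_div_iff (by positivity), mul_comm, show 2 * n + 1 = n + n + 1 by ring,
      ← prod_Icc_fac n n]
    congr 1
    refine Finset.prod_congr rfl fun j _ => ?_
    congr 1
    omega
  rw [e1, e2]
  field_simp

/-- The factor of `phi` depending on `y + z`. -/
noncomputable def gF (x a b s : ℕ) : ℝ :=
  kQ a b x s / Pf (s + b) (s + b) a *
    (wFac (x + a + b + 1 + s) a * wFac s b / (wFac (a + b + 1 + s) a * wFac (x + s) b))

lemma gF_ne (x a b s : ℕ) : gF x a b s ≠ 0 := by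
  unfold gF
  simp [kQ_ne, Pf_ne, wFac_ne]

lemma wFac_succ' (N m : ℕ) : wFac (N + 1) m = wFac N m * (((N + m)! : ℝ) / (N ! : ℝ)) := by
  rw [← mul_div_assoc, ← wFac_succ]
  field_simp

noncomputable def rF (x a b s : ℕ) : ℝ :=
  ((2 * (a + b + x + s) + 1)! : ℝ) * ((a + b + x + s + (a + b) + 1)! : ℝ) * ((s + a + b)! : ℝ) /
    (((a + b + x + s + (a + b + x) + 1)! : ℝ) * ((a + b + x + s)! : ℝ) *
      ((2 * a + 2 * (s + b) + 1)! : ℝ))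

lemma gF_succ (x a b s : ℕ) : gF x a b (s + 1) = gF x a b s * rF x a b s := by
  have h1 := fun n : ℕ => (by positivity : (n ! : ℝ) ≠ 0)
  unfold gF rF
  rw [kQ_succ, show s + 1 + b = s + b + 1 by ring, Pf_succ, 
    show x + a + b + 1 + (s + 1) = (x + a + b + 1 + s) + 1 by ring,
    show a + b + 1 + (s + 1) = (a + b + 1 + s) + 1 by ring,
    show x + (s + 1) = (x + s) + 1 by ring]
  simp only [wFac_succ']
  rw [show a + b + x + s + a + 1 = x + a + b + 1 + s + a by ring,
    show x + a + b + 1 + s = (a + b + x + s) + 1 by ring,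
    show 2 * (b + s) + 1 = 2 * (s + b) + 1 by ring,
    show b + x + s = x + s + b by ring,
    show a + b + 1 + s + a = 2 * a + (s + b) + 1 by ring,
    show a + b + 1 + s = (s + a + b) + 1 by ring,
    show a + (s + b) + 1 = (s + a + b) + 1 by ring]
  simp only [Nat.factorial_succ (a + b + x + s), Nat.factorial_succ (s + a + b),
    Nat.factorial_succ (s + b), Nat.cast_mul]
  generalize hW1 : wFac (a + b + x + s + 1) a = W1
  generalize hW2 : wFac (s + a + b + 1) a = W2
  have := wFac_ne s b
  have := wFac_ne (x + s) b
  have hW2' : W2 ≠ 0 := hW2 ▸ wFac_ne _ _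
  have := Pf_ne (s + b) (s + b) a
  have g1 := h1 s
  have g2 := h1 (s + b)
  have g3 := h1 (x + s)
  have g4 := h1 (x + s + b)
  have g5 := h1 (a + b + x + s)
  have g6 := h1 (s + a + b)
  have g7 := h1 (2 * (s + b) + 1)
  have g8 := h1 (2 * a + (s + b) + 1)
  have g9 := h1 (2 * a + 2 * (s + b) + 1)
  have g10 := h1 (a + b + x + s + 1 + a)
  have g11 := h1 (a + b + x + s + (a + b + x) + 1)
  generalize (s ! : ℝ) = F1 at *
  generalize ((s + b)! : ℝ) = F2 at *
  generalize ((x + s)! : ℝ) = F3 at *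
  generalize ((x + s + b)! : ℝ) = F4 at *
  generalize ((a + b + x + s + 1 + a)! : ℝ) = F10 at *
  generalize ((a + b + x + s + (a + b + x) + 1)! : ℝ) = F11 at *
  generalize ((2 * a + 2 * (s + b) + 1)! : ℝ) = F9 at *
  generalize ((2 * a + (s + b) + 1)! : ℝ) = F8 at *
  generalize ((2 * (s + b) + 1)! : ℝ) = F7 at *
  push_cast
  have u1 : (a + b + x + s + 1 : ℝ) ≠ 0 := by positivity
  have u2 : (s + b + 1 : ℝ) ≠ 0 := by positivity
  have u3 : (s + a + b + 1 : ℝ) ≠ 0 := by positivity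
  field_simp

lemma phi_form (x a b : ℕ) : ∃ A B : ℕ → ℝ, (∀ y, A y ≠ 0) ∧ (∀ z, B z ≠ 0) ∧
    ∀ y z, phi x y z a b = A y * B z * gF x a b (y + z) := by
  obtain ⟨C, hC, hQ⟩ := Q4_form a b x
  refine ⟨fun y => C * Pf y (y + 2 * a) b * (wFac (x + b + y) a / wFac (x + b) a) *
      (wFac (2 * a + b + 1 + y) b / wFac (2 * a + b + 1) b) /
      (wFac (b + y) a / wFac b a) / (wFac (x + 2 * a + b + 1 + y) b / wFac (x + 2 * a + b + 1) b),
    fun z => Pf (z + b) (z + b) a * wFac (z + a + b + 1) a * wFac (x + z) b /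
      (wFac (x + z + a + b + 1) a * wFac z b), ?_, ?_, ?_⟩
  · intro y
    simp [hC, Pf_ne, wFac_ne]
  · intro z
    simp [Pf_ne, wFac_ne]
  · intro y z
    unfold phi gF
    rw [hQ, trapT_fac _ (x + b) y a (by push_cast; ring),
      trapT_fac _ (x + z + a + b + 1) y a (by push_cast; ring),
      trapT_fac _ (2 * a + b + 1) y b (by push_cast; ring),
      trapT_fac _ z y b (by push_cast; ring),
      trapT_fac _ b y a (by push_cast; ring),
      trapT_fac _ (z + a + b + 1) y a (by push_cast; ring),
      trapT_fac _ (x + 2 * a + b + 1) y b (by push_cast; ring),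
      trapT_fac _ (x + z) y b (by push_cast; ring),
      show x + a + b + 1 + (y + z) = x + z + a + b + 1 + y by ring,
      show a + b + 1 + (y + z) = z + a + b + 1 + y by ring,
      show x + (y + z) = x + z + y by ring, show z + y = y + z by ring]
    simp only [div_eq_mul_inv, mul_inv, inv_inv]
    ring

lemma rF_ratio (x a b n : ℕ) : rF x a b n * (((2 * (n : ℝ) + 2 * x + 2 * a + 2 * b + 3)) *
      (n + x + 2 * a + 2 * b + 2)) =
    rF x a b (n + 1) * ((2 * (x : ℝ) + n + 2 * a + 2 * b + 2) * (2 * n + 2 * a + 2 * b + 3)) := by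
  unfold rF
  rw [show 2 * (a + b + x + (n + 1)) + 1 = 2 * (a + b + x + n) + 1 + 1 + 1 by ring,
    show a + b + x + (n + 1) + (a + b) + 1 = a + b + x + n + (a + b) + 1 + 1 by ring,
    show n + 1 + a + b = n + a + b + 1 by ring,
    show a + b + x + (n + 1) + (a + b + x) + 1 = a + b + x + n + (a + b + x) + 1 + 1 by ring,
    show a + b + x + (n + 1) = a + b + x + n + 1 by ring,
    show 2 * a + 2 * (n + 1 + b) + 1 = 2 * a + 2 * (n + b) + 1 + 1 + 1 by ring]
  rw [Nat.factorial_succ (2 * (a + b + x + n) + 1 + 1), Nat.factorial_succ (2 * (a + b + x + n) + 1),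
    Nat.factorial_succ (a + b + x + n + (a + b) + 1), Nat.factorial_succ (n + a + b),
    Nat.factorial_succ (a + b + x + n + (a + b + x) + 1), Nat.factorial_succ (a + b + x + n),
    Nat.factorial_succ (2 * a + 2 * (n + b) + 1 + 1), Nat.factorial_succ (2 * a + 2 * (n + b) + 1)]
  simp only [Nat.cast_mul]
  have h1 := fun n : ℕ => (by positivity : (n ! : ℝ) ≠ 0)
  have g1 := h1 (a + b + x + n)
  have g2 := h1 (a + b + x + n + (a + b + x) + 1)
  have g3 := h1 (2 * a + 2 * (n + b) + 1)
  generalize ((a + b + x + n)! : ℝ) = F1 at *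
  generalize ((a + b + x + n + (a + b + x) + 1)! : ℝ) = F2 at *
  generalize ((2 * a + 2 * (n + b) + 1)! : ℝ) = F3 at *
  generalize ((n + a + b)! : ℝ) = F4 at *
  generalize ((2 * (a + b + x + n) + 1)! : ℝ) = F5 at *
  generalize ((a + b + x + n + (a + b) + 1)! : ℝ) = F6 at *
  simp only [Nat.cast_add, Nat.cast_mul, Nat.cast_one, Nat.cast_ofNat]
  rw [← mul_div_right_comm, ← mul_div_right_comm, div_eq_div_iff (by positivity) (by positivity)]
  ring

/-- first ratio of `φ`'s in the Kuo recurrence. -/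
theorem claim_phi_ratio_one (x y z a b : ℕ) (hx : 1 ≤ x) (hy : 1 ≤ y) (hz : 1 ≤ z)
    (ha : 1 ≤ a) (hb : 1 ≤ b) :
    phi x (y - 1) z a b * phi x y (z - 1) a b /
        (phi x (y - 1) (z - 1) a b * phi x y z a b) =
      (2 * (x : ℝ) + y + z + 2 * a + 2 * b) * (2 * (y : ℝ) + 2 * z + 2 * a + 2 * b - 1) /
        ((2 * (x : ℝ) + 2 * y + 2 * z + 2 * a + 2 * b - 1) *
          ((x : ℝ) + y + z + 2 * a + 2 * b)) := by
  obtain ⟨y, rfl⟩ : ∃ y', y = y' + 1 := ⟨y - 1, by omega⟩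
  obtain ⟨z, rfl⟩ : ∃ z', z = z' + 1 := ⟨z - 1, by omega⟩
  obtain ⟨A, B, hA, hB, h⟩ := phi_form x a b
  simp only [Nat.add_sub_cancel, h]
  rw [show y + (z + 1) = y + z + 1 by ring, show y + 1 + z = y + z + 1 by ring,
    show y + 1 + (z + 1) = y + z + 1 + 1 by ring, gF_succ x a b (y + z + 1), gF_succ x a b (y + z)]
  have r := rF_ratio x a b (y + z)
  have hr : ∀ s, rF x a b s ≠ 0 := fun s => by unfold rF; positivity
  have hr0 := hr (y + z)
  have hr1 := hr (y + z + 1)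
  have hg := gF_ne x a b (y + z)
  have := hA y
  have := hA (y + 1)
  have := hB z
  have := hB (z + 1)
  push_cast at r ⊢
  have e : A y * B (z + 1) * (gF x a b (y + z) * rF x a b (y + z)) *
      (A (y + 1) * B z * (gF x a b (y + z) * rF x a b (y + z))) /
      (A y * B z * gF x a b (y + z) * (A (y + 1) * B (z + 1) *
        (gF x a b (y + z) * rF x a b (y + z) * rF x a b (y + z + 1)))) =
      rF x a b (y + z) / rF x a b (y + z + 1) := by
    field_simp
  have d : (2 * (x : ℝ) + 2 * (y + 1) + 2 * (z + 1) + 2 * a + 2 * b - 1) *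
      (x + (y + 1) + (z + 1) + 2 * a + 2 * b) ≠ 0 := by
    have : (2 * (x : ℝ) + 2 * (y + 1) + 2 * (z + 1) + 2 * a + 2 * b - 1) =
      2 * x + 2 * y + 2 * z + 2 * a + 2 * b + 3 := by ring
    rw [this]
    positivity
  rw [e, div_eq_div_iff hr1 d]
  linear_combination r
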